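/- Let k be a ring, G a group, let 0 → M_1 → M_2 → M_3 → 0 be a short exact sequence of kG-modules, and let f be a proper complexity function. If two of the three modules M_1, M_2, M_3 satisfy c_{kG}(M_i) ≤ f, then so does the third. -/

import Mathlib

open CategoryTheory

noncomputable section

/-- `f : ℕ → ℝ≥0` is a proper complexity function. -/
def IsProperComplexityFunction (f : ℕ → NNReal) : Prop :=
  ∀ n : ℤ, ∃ c : NNReal, ∀ m : ℕ, 0 ≤ (m : ℤ) + n → f ((m : ℤ) + n).toNat < c * f m

/-- The module `P` can be generated by at most `b` elements over `R`. -/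
def RankLE (R : Type) [Ring R] (P : Type) [AddCommGroup P] [Module R P] (b : NNReal) : Prop :=
  ∃ s : Finset P, Submodule.span R (s : Set P) = ⊤ ∧ (s.card : NNReal) ≤ b

/-- `c_R(M) ≤ f` : `M` has a projective resolution whose `n`-th term has rank at most
`d * f n` for some constant `d`. -/
def ComplexityLE (R : Type) [Ring R] (M : ModuleCat.{0} R) (f : ℕ → NNReal) : Prop :=
  ∃ (P : ProjectiveResolution M) (d : NNReal),
    ∀ n : ℕ, RankLE R (P.complex.X n) (d * f n)

/-- `cds_R(M) ≤ f` : complexity at most `f` up to a direct summand. -/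
def CdsLE (R : Type) [Ring R] (M : ModuleCat.{0} R) (f : ℕ → NNReal) : Prop :=
  ∃ N : ModuleCat.{0} R, ComplexityLE R (ModuleCat.of R (M × N)) f

/-- The ring homomorphism `k[H] →+* k[G]` induced by the inclusion of a subgroup `H ≤ G`. -/
def subgroupRingHom (k : Type) [Ring k] {G : Type} [Group G] (H : Subgroup G) :
    MonoidAlgebra k H →+* MonoidAlgebra k G :=
  MonoidAlgebra.mapDomainRingHom k H.subtype

/-- Restriction of a `k[G]`-module to a `k[H]`-module, `H ≤ G`. -/
def resMod (k : Type) [Ring k] {G : Type} [Group G] (H : Subgroup G)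
    (M : ModuleCat.{0} (MonoidAlgebra k G)) : ModuleCat.{0} (MonoidAlgebra k H) :=
  (ModuleCat.restrictScalars (subgroupRingHom k H)).obj M

/-- A group is elementary abelian if it is isomorphic to `(ℤ/p)^r` for a prime `p`. -/
def IsElementaryAbelian (Q : Type) [Group Q] : Prop :=
  ∃ (p r : ℕ), p.Prime ∧ Nonempty (Q ≃* Multiplicative (Fin r → ZMod p))

/-- A group is `p`-elementary abelian if it is isomorphic to `(ℤ/p)^r`. -/
def IsPElementaryAbelian (p : ℕ) (Q : Type) [Group Q] : Prop :=
  ∃ r : ℕ,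
  Nonempty (Q ≃* Multiplicative (Fin r → ZMod p))

section Syzygies

variable {R : Type} [Ring R]

theorem RankLE.mono {P : Type} [AddCommGroup P] [Module R P] {a b : NNReal}
    (h : RankLE R P a) (hab : a ≤ b) : RankLE R P b := by
  obtain ⟨s, hs, hc⟩ := h
  exact ⟨s, hs, hc.trans hab⟩

theorem RankLE.prod {P Q : Type} [AddCommGroup P] [Module R P] [AddCommGroup Q] [Module R Q]
    {a b : NNReal} (hP : RankLE R P a) (hQ : RankLE R Q b) : RankLE R (P × Q) (a + b) := by
  classical
  obtain ⟨s, hs, hsc⟩ := hP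
  obtain ⟨t, ht, htc⟩ := hQ
  refine ⟨s.image (LinearMap.inl R P Q) ∪ t.image (LinearMap.inr R P Q), ?_, ?_⟩
  · rw [Finset.coe_union, Finset.coe_image, Finset.coe_image, Submodule.span_union,
      ← Submodule.map_span, ← Submodule.map_span, hs, ht, Submodule.map_top, Submodule.map_top,
      LinearMap.sup_range_inl_inr]
  · refine le_trans ?_ (add_le_add hsc htc)
    exact_mod_cast (Finset.card_union_le _ _).trans
      (add_le_add Finset.card_image_le Finset.card_image_le)

theorem rankLE_of_subsingleton {P : Type} [AddCommGroup P] [Module R P] [Subsingleton P]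
    (b : NNReal) : RankLE R P b :=
  ⟨∅, Subsingleton.elim _ _, by simp⟩

/-- A linear map killed by `v` factors through the injection `u` in an exact sequence. -/
theorem exists_comp_eq_of_exact {A B C X : Type} [AddCommGroup A] [Module R A]
    [AddCommGroup B] [Module R B] [AddCommGroup C] [Module R C] [AddCommGroup X] [Module R X]
    {u : A →ₗ[R] B} {v : B →ₗ[R] C} (hu : Function.Injective u) (huv : Function.Exact u v)
    (g : X →ₗ[R] B) (hg : ∀ x, v (g x) = 0) : ∃ h : X →ₗ[R] A, ∀ x, u (h x) = g x := by
  let e := LinearEquiv.ofInjective u hu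
  refine ⟨e.symm.toLinearMap ∘ₗ g.codRestrict (LinearMap.range u) fun x => (huv _).1 (hg x),
    fun x => ?_⟩
  exact congrArg Subtype.val
    (e.apply_symm_apply (g.codRestrict (LinearMap.range u) (fun x => (huv _).1 (hg x)) x))

/-- `K` is the kernel of a surjection onto `M` from a projective module that can be generated
by at most `b` elements. -/
def IsSyzygy (b : NNReal) (K M : ModuleCat.{0} R) : Prop :=
  ∃ (P : ModuleCat.{0} R) (i : K →ₗ[R] P) (p : P →ₗ[R] M), Module.Projective R P ∧
    RankLE R P b ∧ Function.Injective i ∧ Function.Surjective p ∧ Function.Exact i p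

/-- `M` has a projective resolution whose `n`-th term can be generated by `b n` elements,
expressed through its successive syzygies. -/
def HasSyzygies (b : ℕ → NNReal) (M : ModuleCat.{0} R) : Prop :=
  ∃ Ω : ℕ → ModuleCat.{0} R, Ω 0 = M ∧ ∀ n, IsSyzygy (b n) (Ω (n + 1)) (Ω n)

theorem isSyzygy_ker {b : NNReal} {P M : ModuleCat.{0} R} [Module.Projective R P]
    (hP : RankLE R P b) (p : P →ₗ[R] M) (hp : Function.Surjective p) :
    IsSyzygy b (ModuleCat.of R (LinearMap.ker p)) M :=
  ⟨P, (LinearMap.ker p).subtype, p, inferInstance, hP, Subtype.val_injective, hp,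
    LinearMap.exact_subtype_ker_map p⟩

theorem IsSyzygy.mono {a b : NNReal} {K M : ModuleCat.{0} R} (h : IsSyzygy a K M)
    (hab : a ≤ b) : IsSyzygy b K M := by
  obtain ⟨P, i, p, hP, hr, h⟩ := h
  exact ⟨P, i, p, hP, hr.mono hab, h⟩

theorem HasSyzygies.mono {a b : ℕ → NNReal} {M : ModuleCat.{0} R} (h : HasSyzygies a M)
    (hab : ∀ n, a n ≤ b n) : HasSyzygies b M := by
  obtain ⟨Ω, h0, hΩ⟩ := h
  exact ⟨Ω, h0, fun n => (hΩ n).mono (hab n)⟩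

/-- Coinduction principle for `HasSyzygies`. -/
theorem HasSyzygies.of_step {b : ℕ → NNReal} (S : ℕ → ModuleCat.{0} R → Prop)
    (step : ∀ n M, S n M → ∃ K, IsSyzygy (b n) K M ∧ S (n + 1) K)
    {M : ModuleCat.{0} R} (hM : S 0 M) : HasSyzygies b M := by
  choose next hnext using step
  let seq : ∀ n, { K : ModuleCat.{0} R // S n K } := fun n =>
    Nat.rec ⟨M, hM⟩ (fun n K => ⟨next n K.1 K.2, (hnext n K.1 K.2).2⟩) n
  exact ⟨fun n => (seq n).1, rfl, fun n => (hnext n (seq n).1 (seq n).2).1⟩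

theorem HasSyzygies.cons {b : ℕ → NNReal} {K M : ModuleCat.{0} R} (h : IsSyzygy (b 0) K M)
    (hK : HasSyzygies (fun n => b (n + 1)) K) : HasSyzygies b M := by
  obtain ⟨Ω, rfl, hΩ⟩ := hK
  refine ⟨fun n => Nat.casesOn n M Ω, rfl, fun n => ?_⟩
  cases n with
  | zero => exact h
  | succ n => exact hΩ n

theorem HasSyzygies.exists_tail {b : ℕ → NNReal} {M : ModuleCat.{0} R} (h : HasSyzygies b M) :
    ∃ K, IsSyzygy (b 0) K M ∧ HasSyzygies (fun n => b (n + 1)) K := by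
  obtain ⟨Ω, rfl, hΩ⟩ := h
  exact ⟨Ω 1, hΩ 0, fun n => Ω (n + 1), rfl, fun n => hΩ (n + 1)⟩

theorem HasSyzygies.of_projective {b : ℕ → NNReal} {P : ModuleCat.{0} R}
    [Module.Projective R P] (hP : RankLE R P (b 0)) : HasSyzygies b P := by
  refine .cons (isSyzygy_ker hP LinearMap.id Function.surjective_id) ?_
  refine .of_step (fun _ K => Subsingleton K) (fun n K hK => ?_) ?_
  · have : Module.Projective R K := Module.Projective.of_basis (Module.Basis.empty (ι := Empty) K)
    exact ⟨_, isSyzygy_ker (P := K) (rankLE_of_subsingleton _) LinearMap.id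
      Function.surjective_id, inferInstanceAs (Subsingleton (LinearMap.ker LinearMap.id))⟩
  · rw [LinearMap.ker_id]
    exact inferInstanceAs (Subsingleton (⊥ : Submodule R P))

/-- The horseshoe lemma, one step at a time. -/
theorem IsSyzygy.exists_extension {a c : NNReal} {A B C A' C' : ModuleCat.{0} R}
    {u : A →ₗ[R] B} {v : B →ₗ[R] C} (hu : Function.Injective u) (hv : Function.Surjective v)
    (huv : Function.Exact u v) (hA : IsSyzygy a A' A) (hC : IsSyzygy c C' C) :
    ∃ (B' : ModuleCat.{0} R) (u' : A' →ₗ[R] B') (v' : B' →ₗ[R] C'), IsSyzygy (a + c) B' B ∧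
      Function.Injective u' ∧ Function.Surjective v' ∧ Function.Exact u' v' := by
  obtain ⟨P, i, p, hP, hPr, hi, hp, hip⟩ := hA
  obtain ⟨Q, j, q, hQ, hQr, hj, hq, hjq⟩ := hC
  obtain ⟨l, hl⟩ := Module.projective_lifting_property v q hv
  replace hl : ∀ y, v (l y) = q y := fun y => LinearMap.congr_fun hl y
  let w : P × Q →ₗ[R] B := (u ∘ₗ p).coprod l
  have hw : ∀ x y, w (x, y) = u (p x) + l y := fun x y => rfl
  have hvw : ∀ z, v (w z) = q z.2 := fun z => by
    rw [← Prod.mk.eta (p := z), hw, map_add, huv.apply_apply_eq_zero, hl, zero_add]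
  have hws : Function.Surjective w := fun b => by
    obtain ⟨y, hy⟩ := hq (v b)
    obtain ⟨x', hx'⟩ := (huv (b - l y)).1 (by rw [map_sub, hl, hy, sub_self])
    obtain ⟨x, rfl⟩ := hp x'
    exact ⟨(x, y), by rw [hw, hx', sub_add_cancel]⟩
  obtain ⟨v', hv'⟩ := exists_comp_eq_of_exact hj hjq
    (LinearMap.snd R P Q ∘ₗ (LinearMap.ker w).subtype) fun z => by
      have := hvw z.1
      rw [LinearMap.mem_ker.1 z.2, map_zero] at this
      exact this.symm
  replace hv' : ∀ z, j (v' z) = z.1.2 := hv'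
  let u' : A' →ₗ[R] LinearMap.ker w := (LinearMap.inl R P Q ∘ₗ i).codRestrict _ fun x => by
    rw [LinearMap.mem_ker]
    change w (i x, 0) = 0
    rw [hw, hip.apply_apply_eq_zero, map_zero, map_zero, add_zero]
  have hu' : ∀ x, (u' x).1 = (i x, 0) := fun x => rfl
  refine ⟨ModuleCat.of R (LinearMap.ker w), u', v',
    isSyzygy_ker (P := ModuleCat.of R (P × Q)) (hPr.prod hQr) w hws, ?_, ?_, ?_⟩
  · intro x y hxy
    have := congrArg (fun z => z.1.1) hxy
    exact hi this
  · intro y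
    obtain ⟨x', hx'⟩ := (huv (l (j y))).1 (by rw [hl, hjq.apply_apply_eq_zero])
    obtain ⟨x, rfl⟩ := hp x'
    refine ⟨⟨(-x, j y), ?_⟩, hj (hv' _)⟩
    rw [LinearMap.mem_ker, hw, map_neg, map_neg, hx', neg_add_cancel]
  · intro z
    constructor
    · intro hz
      have hz2 : z.1.2 = 0 := by rw [← hv', hz, map_zero]
      have hpz : p z.1.1 = 0 := hu (by
        have := LinearMap.mem_ker.1 z.2
        rw [← Prod.mk.eta (p := z.1), hw, hz2, map_zero, add_zero] at this
        rw [this, map_zero])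
      obtain ⟨x, hx⟩ := (hip _).1 hpz
      exact ⟨x, Subtype.ext (by rw [hu', hx, ← hz2])⟩
    · rintro ⟨x, rfl⟩
      exact hj (by rw [hv', hu', map_zero])

theorem HasSyzygies.extension {a c : ℕ → NNReal} {A B C : ModuleCat.{0} R}
    {u : A →ₗ[R] B} {v : B →ₗ[R] C} (hu : Function.Injective u) (hv : Function.Surjective v)
    (huv : Function.Exact u v) (hA : HasSyzygies a A) (hC : HasSyzygies c C) :
    HasSyzygies (fun n => a n + c n) B := by
  obtain ⟨Φ, rfl, hΦ⟩ := hA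
  obtain ⟨Ψ, rfl, hΨ⟩ := hC
  refine .of_step (fun n K => ∃ (u : Φ n →ₗ[R] K) (v : K →ₗ[R] Ψ n),
    Function.Injective u ∧ Function.Surjective v ∧ Function.Exact u v) ?_ ⟨u, v, hu, hv, huv⟩
  rintro n K ⟨u, v, hu, hv, huv⟩
  obtain ⟨K', u', v', hK', h⟩ := IsSyzygy.exists_extension hu hv huv (hΦ n) (hΨ n)
  exact ⟨K', hK', u', v', h⟩

theorem HasSyzygies.quotient {a b : ℕ → NNReal} {A B C : ModuleCat.{0} R}
    {u : A →ₗ[R] B} {v : B →ₗ[R] C} (hu : Function.Injective u) (hv : Function.Surjective v)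
    (huv : Function.Exact u v) (hA : HasSyzygies a A) (hB : HasSyzygies b B) :
    HasSyzygies (fun n => b n + Nat.casesOn n 0 a) C := by
  obtain ⟨B', ⟨P, i, p, hP, hPr, hi, hp, hip⟩, hB'⟩ := hB.exists_tail
  let w : P →ₗ[R] C := v ∘ₗ p
  refine .cons (isSyzygy_ker (by simpa using hPr) w (hv.comp hp)) ?_
  obtain ⟨r, hr⟩ := exists_comp_eq_of_exact hu huv
    (p ∘ₗ (LinearMap.ker w).subtype) fun z => z.2
  replace hr : ∀ z, u (r z) = p z.1 := hr
  let i' : B' →ₗ[R] LinearMap.ker w := i.codRestrict _ fun x => by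
    rw [LinearMap.mem_ker]
    change v (p (i x)) = 0
    rw [hip.apply_apply_eq_zero, map_zero]
  refine HasSyzygies.extension (u := i') (v := r) ?_ ?_ ?_ hB' hA
  · intro x y hxy
    exact hi (congrArg Subtype.val hxy)
  · intro x
    obtain ⟨y, hy⟩ := hp (u x)
    refine ⟨⟨y, ?_⟩, hu ((hr _).trans hy)⟩
    rw [LinearMap.mem_ker]
    change v (p y) = 0
    rw [hy, huv.apply_apply_eq_zero]
  · intro z
    constructor
    · intro hz
      obtain ⟨x, hx⟩ := (hip z.1).1 (by rw [← hr, hz, map_zero])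
      exact ⟨x, Subtype.ext hx⟩
    · rintro ⟨x, rfl⟩
      exact hu ((hr _).trans (by rw [map_zero]; exact hip.apply_apply_eq_zero x))

/-- If `P` is a projective module mapping onto `C`, then `A × P` is an extension of `B` by the
kernel of `P → C`, and `A` is the quotient of `A × P` by `P`. -/
theorem HasSyzygies.kernel {b c : ℕ → NNReal} {A B C : ModuleCat.{0} R}
    {u : A →ₗ[R] B} {v : B →ₗ[R] C} (hu : Function.Injective u) (hv : Function.Surjective v)
    (huv : Function.Exact u v) (hB : HasSyzygies b B) (hC : HasSyzygies c C) :
    HasSyzygies (fun n => (c (n + 1) + b n) + Nat.casesOn n 0 c) A := by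
  obtain ⟨C', ⟨P, i, p, hP, hPr, hi, hp, hip⟩, hC'⟩ := hC.exists_tail
  obtain ⟨l, hl⟩ := Module.projective_lifting_property v p hv
  replace hl : ∀ y, v (l y) = p y := fun y => LinearMap.congr_fun hl y
  obtain ⟨t, ht⟩ := exists_comp_eq_of_exact hu huv (l ∘ₗ i) fun x => by
    change v (l (i x)) = 0
    rw [hl, hip.apply_apply_eq_zero]
  replace ht : ∀ x, u (t x) = l (i x) := ht
  have hAP : HasSyzygies (fun n => c (n + 1) + b n) (ModuleCat.of R (A × P)) := by
    refine HasSyzygies.extension (u := (-t).prod i) (v := u.coprod l) ?_ ?_ ?_ hC' hB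
    · intro x y hxy
      exact hi (congrArg Prod.snd hxy)
    · intro m
      obtain ⟨y, hy⟩ := hp (v m)
      obtain ⟨x, hx⟩ := (huv (m - l y)).1 (by rw [map_sub, hl, hy, sub_self])
      exact ⟨(x, y), by rw [LinearMap.coprod_apply, hx, sub_add_cancel]⟩
    · rintro ⟨x, y⟩
      rw [LinearMap.coprod_apply]
      constructor
      · intro hxy
        have hy : p y = 0 := by
          have := congrArg v hxy
          rwa [map_add, huv.apply_apply_eq_zero, hl, zero_add, map_zero] at this
        obtain ⟨z, rfl⟩ := (hip y).1 hy
        refine ⟨z, Prod.ext (hu ?_) rfl⟩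
        change u (-t z) = u x
        rw [map_neg, ht, eq_comm]
        exact eq_neg_of_add_eq_zero_left hxy
      · rintro ⟨z, hz⟩
        obtain ⟨rfl, rfl⟩ := Prod.mk.inj hz
        change u (-t z) + l (i z) = 0
        rw [map_neg, ht, neg_add_cancel]
  exact HasSyzygies.quotient (u := LinearMap.inr R A P) (v := LinearMap.fst R A P)
    LinearMap.inr_injective LinearMap.fst_surjective Function.Exact.inr_fst
    (.of_projective hPr) hAP

theorem hasSyzygies_of_projectiveResolution {b : ℕ → NNReal} {M : ModuleCat.{0} R}
    (P : ProjectiveResolution M) (hP : ∀ n, RankLE R (P.complex.X n) (b n)) :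
    HasSyzygies b M := by
  refine .of_step (fun n K => ∃ q : P.complex.X n →ₗ[R] K, Function.Surjective q ∧
    Function.Exact (P.complex.d (n + 1) n).hom q) ?_ ?_
  · rintro n K ⟨q, hq, hdq⟩
    refine ⟨ModuleCat.of R (LinearMap.range (P.complex.d (n + 1) n).hom),
      ⟨P.complex.X n, Submodule.subtype _, q,
        (IsProjective.iff_projective _).2 (P.projective n), hP n, Subtype.val_injective, hq, ?_⟩,
      (P.complex.d (n + 1) n).hom.rangeRestrict, LinearMap.surjective_rangeRestrict _, ?_⟩
    · intro x
      rw [hdq x]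
      simp
    · have := (ShortComplex.ShortExact.moduleCat_exact_iff_function_exact _).1 (P.exact_succ n)
      intro x
      rw [← this x, ← Subtype.val_inj]
      rfl
  · exact ⟨(P.π.f 0).hom, (ModuleCat.epi_iff_surjective _).1 inferInstance,
      (ShortComplex.ShortExact.moduleCat_exact_iff_function_exact _).1 P.exact₀⟩

theorem exists_projectiveResolution_of_hasSyzygies {b : ℕ → NNReal} {M : ModuleCat.{0} R}
    (h : HasSyzygies b M) :
    ∃ P : ProjectiveResolution M, ∀ n, RankLE R (P.complex.X n) (b n) := by
  obtain ⟨Ω, rfl, hΩ⟩ := h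
  choose P i p hP hr hi hp hip using hΩ
  let d : ∀ n, P (n + 1) ⟶ P n := fun n => ModuleCat.ofHom (i n ∘ₗ p (n + 1))
  have hd : ∀ n, Function.Exact (d n) (p n) := fun n x => by
    rw [hip n x]
    constructor
    · rintro ⟨y, rfl⟩
      obtain ⟨z, rfl⟩ := hp (n + 1) y
      exact ⟨z, rfl⟩
    · rintro ⟨z, rfl⟩
      exact ⟨p (n + 1) z, rfl⟩
  have hdd : ∀ n, Function.Exact (d (n + 1)) (d n) := fun n x => by
    rw [← hd (n + 1) x]
    exact map_eq_zero_iff (i n) (hi n)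
  have sq : ∀ n, d (n + 1) ≫ d n = 0 := fun n => by
    ext x
    exact (hdd n).apply_apply_eq_zero x
  let C : ChainComplex (ModuleCat.{0} R) ℕ := ChainComplex.of P d sq
  have hC : ∀ n, C.d (n + 1) n = d n := fun n => ChainComplex.of_d _ _ _
  let ε : C.X 0 ⟶ Ω 0 := ModuleCat.ofHom (p 0)
  have hε : C.d 1 0 ≫ ε = 0 := by
    rw [hC 0]
    ext x
    exact (hd 0).apply_apply_eq_zero x
  refine ⟨{ complex := C
            projective := fun n => (IsProjective.iff_projective (P n)).1 (hP n)
            π := (ChainComplex.toSingle₀Equiv _ _).symm ⟨ε, hε⟩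
            quasiIso := ⟨fun n => ?_⟩ }, hr⟩
  cases n with
  | zero =>
    rw [ChainComplex.quasiIsoAt₀_iff, ShortComplex.quasiIso_iff_of_zeros']
    · refine (ShortComplex.exact_and_epi_g_iff_of_iso (S₂ := ShortComplex.mk _ _ hε) ?_).2 ⟨?_, ?_⟩
      · exact ShortComplex.isoMk (Iso.refl _) (Iso.refl _) (Iso.refl _)
          ((Category.id_comp _).trans (Category.comp_id _).symm)
          ((Category.id_comp _).trans (Category.comp_id _).symm)
      · rw [ShortComplex.ShortExact.moduleCat_exact_iff_function_exact]
        change Function.Exact (C.d 1 0) (p 0)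
        rw [hC 0]
        exact hd 0
      · exact (ModuleCat.epi_iff_surjective _).2 (hp 0)
    all_goals rfl
  | succ n =>
    rw [quasiIsoAt_iff_exactAt' _ _ (ChainComplex.exactAt_succ_single_obj _ _),
      HomologicalComplex.exactAt_iff' _ (n + 1 + 1) (n + 1) n (by simp) (by simp),
      ShortComplex.ShortExact.moduleCat_exact_iff_function_exact]
    change Function.Exact (C.d (n + 1 + 1) (n + 1)) (C.d (n + 1) n)
    rw [hC, hC]
    exact hdd n

theorem complexityLE_iff_hasSyzygies {M : ModuleCat.{0} R} {f : ℕ → NNReal} :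
    ComplexityLE R M f ↔ ∃ d : NNReal, HasSyzygies (fun n => d * f n) M := by
  constructor
  · rintro ⟨P, d, hP⟩
    exact ⟨d, hasSyzygies_of_projectiveResolution P hP⟩
  · rintro ⟨d, h⟩
    obtain ⟨P, hP⟩ := exists_projectiveResolution_of_hasSyzygies h
    exact ⟨P, d, hP⟩

end Syzygies

theorem IsProperComplexityFunction.exists_succ_le {f : ℕ → NNReal}
    (hf : IsProperComplexityFunction f) : ∃ c : NNReal, ∀ n, f (n + 1) ≤ c * f n := by
  obtain ⟨c, hc⟩ := hf 1
  exact ⟨c, fun n => (hc n (by positivity)).le⟩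

theorem IsProperComplexityFunction.exists_le_succ {f : ℕ → NNReal}
    (hf : IsProperComplexityFunction f) : ∃ c : NNReal, ∀ n, f n ≤ c * f (n + 1) := by
  obtain ⟨c, hc⟩ := hf (-1)
  refine ⟨c, fun n => ?_⟩
  have := hc (n + 1) (by push_cast; linarith)
  rw [show (((n + 1 : ℕ) : ℤ) + -1).toNat = n by omega] at this
  exact this.le

/-- In a short exact sequence `0 → M₁ → M₂ → M₃ → 0` of `kG`-modules, if two of the three
modules have complexity `≤ f` then so does the third. -/
theorem complexity_two_of_three
    (k : Type) [Ring k] (G : Type) [Group G]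
    (M₁ M₂ M₃ : ModuleCat.{0} (MonoidAlgebra k G))
    (u : M₁ ⟶ M₂) (v : M₂ ⟶ M₃)
    (hu : Function.Injective u) (hv : Function.Surjective v)
    (huv : Function.Exact u v)
    (f : ℕ → NNReal) (hf : IsProperComplexityFunction f) :
    (ComplexityLE (MonoidAlgebra k G) M₁ f → ComplexityLE (MonoidAlgebra k G) M₂ f →
      ComplexityLE (MonoidAlgebra k G) M₃ f) ∧
    (ComplexityLE (MonoidAlgebra k G) M₁ f → ComplexityLE (MonoidAlgebra k G) M₃ f →
      ComplexityLE (MonoidAlgebra k G) M₂ f) ∧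
    (ComplexityLE (MonoidAlgebra k G) M₂ f → ComplexityLE (MonoidAlgebra k G) M₃ f →
      ComplexityLE (MonoidAlgebra k G) M₁ f) := by
  simp only [complexityLE_iff_hasSyzygies]
  obtain ⟨c, hc⟩ := hf.exists_le_succ
  obtain ⟨c', hc'⟩ := hf.exists_succ_le
  refine ⟨?_, ?_, ?_⟩
  · rintro ⟨d₁, h₁⟩ ⟨d₂, h₂⟩
    refine ⟨d₂ + d₁ * c, (h₁.quotient (u := u.hom) (v := v.hom) hu hv huv h₂).mono fun n => ?_⟩
    rw [add_mul, mul_assoc]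
    cases n with
    | zero => simp
    | succ n =>
      exact add_le_add le_rfl (mul_le_mul_right (hc n) d₁)
  · rintro ⟨d₁, h₁⟩ ⟨d₃, h₃⟩
    exact ⟨d₁ + d₃, (h₁.extension (u := u.hom) (v := v.hom) hu hv huv h₃).mono
      fun n => (add_mul _ _ _).ge⟩
  · rintro ⟨d₂, h₂⟩ ⟨d₃, h₃⟩
    refine ⟨d₃ * c' + d₂ + d₃ * c, (h₂.kernel (u := u.hom) (v := v.hom) hu hv huv h₃).mono fun n => ?_⟩
    rw [add_mul, add_mul, mul_assoc, mul_assoc d₃ c]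
    refine add_le_add (add_le_add ?_ le_rfl) ?_
    · gcongr
      exact hc' n
    · cases n with
      | zero => simp
      | succ n =>
        exact mul_le_mul_right (hc n) d₃
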